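/- Let $k$ be an algebraically closed field of characteristic zero, $K$ a field extension of $k$, and let $u_1,u_2,v_1,v_2,w_1,w_2 \in K$ be algebraically independent over $k$. Define $t_{i,j,k} := (u_i+v_j)/(v_j+w_k)$. If $x \in K$ is algebraic over each of the four subfields $k(t_{1,1,1},t_{1,1,2})$, $k(t_{1,2,1},t_{1,2,2})$, $k(t_{2,1,1},t_{2,1,2})$, and $k(t_{2,2,1},t_{2,2,2})$, then $x$ is algebraic over $k$. -/

import Mathlib

/-- Two finite sets that together span an independent set at least as large as the sum of their
sizes have closures meeting only in the closure of the empty set. -/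
theorem Matroid.Indep.closure_inter_closure_eq_closure_empty {α : Type*} {M : Matroid α}
    {I S T : Set α} (hI : M.Indep I) (hS : S.Finite) (hT : T.Finite)
    (hIST : I ⊆ M.closure (S ∪ T)) (hcard : S.encard + T.encard ≤ I.encard) :
    M.closure S ∩ M.closure T = M.closure ∅ := by
  have hle : I.encard ≤ M.eRk (S ∪ T) := by
    rw [← hI.eRk_eq_encard, ← M.eRk_closure_eq (S ∪ T)]
    exact M.eRk_mono hIST
  have hST : M.Indep (S ∪ T) := by
    rw [Matroid.indep_iff_eRk_eq_encard_of_finite (hS.union hT)]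
    exact (M.eRk_le_encard _).antisymm
      ((Set.encard_union_le S T).trans (hcard.trans hle))
  have hinter : S ∩ T = ∅ := by
    rw [← Set.encard_eq_zero]
    have hsum := Set.encard_union_add_encard_inter S T
    have hunion : (S ∪ T).encard ≠ ⊤ := Set.encard_ne_top_iff.mpr (hS.union hT)
    have hbound : (S ∪ T).encard + (S ∩ T).encard ≤ (S ∪ T).encard + 0 := by
      rw [hsum, add_zero]
      exact hcard.trans (hle.trans (M.eRk_le_encard _))
    exact nonpos_iff_eq_zero.mp ((ENat.add_le_add_iff_left hunion).mp hbound)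
  rw [← hST.closure_inter_eq_inter_closure, hinter]

theorem AlgebraicIndependent.add_ne_zero {ι R A : Type*} [CommRing R] [Nontrivial R] [CommRing A]
    [Algebra R A] {f : ι → A} (hf : AlgebraicIndependent R f) {i j : ι} (hij : i ≠ j) :
    f i + f j ≠ 0 := by
  classical
  intro h
  have hX : (MvPolynomial.X i + MvPolynomial.X j : MvPolynomial ι R) = 0 :=
    hf.eq_zero_of_aeval_eq_zero _ (by simpa using h)
  simpa [hij.symm] using congrArg (MvPolynomial.eval (Pi.single i (1 : R))) hX

section

variable {k K : Type*} [Field k] [Field K] [Algebra k K]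

theorem AlgebraicIndependent.mem_matroid_closure_iff {s : Set K} {x : K} :
    x ∈ (AlgebraicIndependent.matroid k K).closure s ↔
      IsAlgebraic (IntermediateField.adjoin k s) x := by
  rw [AlgebraicIndependent.matroid_closure_eq, IntermediateField.isAlgebraic_adjoin_iff]
  rfl

theorem AlgebraicIndependent.mem_matroid_closure_of_mem_adjoin {s : Set K} {x : K}
    (hx : x ∈ IntermediateField.adjoin k s) :
    x ∈ (AlgebraicIndependent.matroid k K).closure s :=
  mem_matroid_closure_iff.mpr (isAlgebraic_algebraMap (⟨x, hx⟩ : IntermediateField.adjoin k s))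

/-- The numbers `(u + v) / (v + w₁)`, `(u + v) / (v + w₂)` lie in the field generated
by `u`, `v`, `w₁`, `w₂`. -/
theorem twisted_pair_subset_adjoin (u v w₁ w₂ : K) :
    {(u + v) / (v + w₁), (u + v) / (v + w₂)} ⊆
      (IntermediateField.adjoin k {u, v, w₁, w₂} : Set K) := by
  have hmem : ∀ y ∈ ({u, v, w₁, w₂} : Set K), y ∈ IntermediateField.adjoin k {u, v, w₁, w₂} :=
    fun y hy => IntermediateField.subset_adjoin k _ hy
  have hu := hmem u (by simp)
  have hv := hmem v (by simp)
  rintro y (rfl | rfl)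
  · exact div_mem (add_mem hu hv) (add_mem hv (hmem w₁ (by simp)))
  · exact div_mem (add_mem hu hv) (add_mem hv (hmem w₂ (by simp)))

/-- The elements `u`, `v` can be recovered rationally from `w₁`, `w₂` and the two ratios
`(u + v) / (v + w₁)`, `(u + v) / (v + w₂)`. -/
theorem subset_adjoin_twisted_pair {u v w₁ w₂ : K} (huv : u + v ≠ 0) (hvw₁ : v + w₁ ≠ 0)
    (hvw₂ : v + w₂ ≠ 0) (hw : w₁ ≠ w₂) :
    {u, v, w₁, w₂} ⊆ (IntermediateField.adjoin k
      ({(u + v) / (v + w₁), (u + v) / (v + w₂)} ∪ {w₁, w₂}) : Set K) := by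
  set F := IntermediateField.adjoin k
    ({(u + v) / (v + w₁), (u + v) / (v + w₂)} ∪ {w₁, w₂})
  have hmem : ∀ y ∈ ({(u + v) / (v + w₁), (u + v) / (v + w₂)} ∪ {w₁, w₂} : Set K), y ∈ F :=
    fun y hy => IntermediateField.subset_adjoin k _ hy
  have ht₁ := hmem ((u + v) / (v + w₁)) (by simp)
  have ht₂ := hmem ((u + v) / (v + w₂)) (by simp)
  have hw₁ := hmem w₁ (by simp)
  have hw₂ := hmem w₂ (by simp)
  have hr : (v + w₂) / (v + w₁) ∈ F := by
    have heq : (v + w₂) / (v + w₁) = (u + v) / (v + w₁) / ((u + v) / (v + w₂)) := by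
      field_simp
    rw [heq]
    exact div_mem ht₁ ht₂
  have hv : v ∈ F := by
    have hr1 : (v + w₂) / (v + w₁) - 1 ≠ 0 := by
      rw [sub_ne_zero, Ne, div_eq_one_iff_eq hvw₁, add_right_inj]
      exact hw.symm
    have heq : v = (w₂ - (v + w₂) / (v + w₁) * w₁) / ((v + w₂) / (v + w₁) - 1) := by
      rw [eq_div_iff hr1]
      field_simp
      ring
    rw [heq]
    exact div_mem (sub_mem hw₂ (mul_mem hr hw₁)) (sub_mem hr (one_mem F))
  have hu : u ∈ F := by
    have heq : u = (u + v) / (v + w₁) * (v + w₁) - v := by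
      field_simp
      ring
    rw [heq]
    exact sub_mem (mul_mem ht₁ (add_mem hv hw₁)) hv
  rintro y (rfl | rfl | rfl | rfl) <;> assumption

end

/-- With `u₁,u₂,v₁,v₂,w₁,w₂ ∈ K` algebraically independent over the
algebraically closed field `k` of characteristic zero and `t i j l = (uᵢ+vⱼ)/(vⱼ+wₗ)`,
any `x ∈ K` algebraic over each of the four subfields `k(tᵢⱼ₁, tᵢⱼ₂)` (the frame `𝓘₁`)
is algebraic over `k`. -/
theorem twisted_frame_one_base {k K : Type*} [Field k] [IsAlgClosed k] [CharZero k]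
    [Field K] [Algebra k K] (u₁ u₂ v₁ v₂ w₁ w₂ : K)
    (hind : AlgebraicIndependent k ![u₁, u₂, v₁, v₂, w₁, w₂]) (x : K)
    (h11 : IsAlgebraic (IntermediateField.adjoin k
      {(u₁ + v₁) / (v₁ + w₁), (u₁ + v₁) / (v₁ + w₂)} : IntermediateField k K) x)
    (h12 : IsAlgebraic (IntermediateField.adjoin k
      {(u₁ + v₂) / (v₂ + w₁), (u₁ + v₂) / (v₂ + w₂)} : IntermediateField k K) x)
    (h21 : IsAlgebraic (IntermediateField.adjoin k
      {(u₂ + v₁) / (v₁ + w₁), (u₂ + v₁) / (v₁ + w₂)} : IntermediateField k K) x)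
    (h22 : IsAlgebraic (IntermediateField.adjoin k
      {(u₂ + v₂) / (v₂ + w₁), (u₂ + v₂) / (v₂ + w₂)} : IntermediateField k K) x) :
    IsAlgebraic k x := by
  set M := AlgebraicIndependent.matroid k K
  set f := ![u₁, u₂, v₁, v₂, w₁, w₂] with hf
  have hinj : Function.Injective f := hind.injective
  have hrange : M.Indep (Set.range f) := hind.coe_range
  have hclosure : ∀ u v : K, IsAlgebraic (IntermediateField.adjoin k
      {(u + v) / (v + w₁), (u + v) / (v + w₂)} : IntermediateField k K) x →
      x ∈ M.closure {u, v, w₁, w₂} := fun u v h =>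
    M.closure_subset_closure_of_subset_closure
      (fun _ hy => AlgebraicIndependent.mem_matroid_closure_of_mem_adjoin
        (twisted_pair_subset_adjoin u v w₁ w₂ hy))
      (AlgebraicIndependent.mem_matroid_closure_iff.mpr h)
  have himage₁ : f '' {0, 2, 4, 5} = {u₁, v₁, w₁, w₂} := by
    simp [Set.image_insert_eq, hf]
  have himage₂ : f '' {1, 3, 4, 5} = {u₂, v₂, w₁, w₂} := by
    simp [Set.image_insert_eq, hf]
  have hinter : ({u₁, v₁, w₁, w₂} ∩ {u₂, v₂, w₁, w₂} : Set K) = {w₁, w₂} := by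
    have hidx : ({0, 2, 4, 5} ∩ {1, 3, 4, 5} : Set (Fin 6)) = {4, 5} := by
      ext i
      fin_cases i <;> simp
    rw [← himage₁, ← himage₂, ← Set.image_inter hinj, hidx]
    simp [Set.image_insert_eq, hf]
  have hxw : x ∈ M.closure {w₁, w₂} := by
    have hunion : M.Indep ({u₁, v₁, w₁, w₂} ∪ {u₂, v₂, w₁, w₂}) := by
      rw [← himage₁, ← himage₂, ← Set.image_union]
      exact hrange.subset (Set.image_subset_range _ _)
    rw [← hinter, hunion.closure_inter_eq_inter_closure]
    exact ⟨hclosure u₁ v₁ h11, hclosure u₂ v₂ h22⟩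
  have hindep : M.Indep {u₁, v₁, w₁, w₂} :=
    hrange.subset (himage₁ ▸ Set.image_subset_range _ _)
  have hspan : {u₁, v₁, w₁, w₂} ⊆ M.closure
      ({(u₁ + v₁) / (v₁ + w₁), (u₁ + v₁) / (v₁ + w₂)} ∪ {w₁, w₂}) := fun _ hy =>
    AlgebraicIndependent.mem_matroid_closure_of_mem_adjoin <| subset_adjoin_twisted_pair
      (hind.add_ne_zero (i := 0) (j := 2) (by decide))
      (hind.add_ne_zero (i := 2) (j := 4) (by decide))
      (hind.add_ne_zero (i := 2) (j := 5) (by decide))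
      (hinj.ne (a₁ := 4) (a₂ := 5) (by decide)) hy
  have hcard : ({(u₁ + v₁) / (v₁ + w₁), (u₁ + v₁) / (v₁ + w₂)} : Set K).encard +
      ({w₁, w₂} : Set K).encard ≤ ({u₁, v₁, w₁, w₂} : Set K).encard := by
    have hfour : ({0, 2, 4, 5} : Set (Fin 6)).encard = 4 := by
      rw [Set.encard_eq_coe_toFinset_card]
      rfl
    rw [← himage₁, hinj.encard_image, hfour]
    have hpair : ∀ a b : K, ({a, b} : Set K).encard ≤ 2 := fun a b =>
      (Set.encard_insert_le {b} a).trans (by rw [Set.encard_singleton, one_add_one_eq_two])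
    exact (add_le_add (hpair _ _) (hpair _ _)).trans (by norm_num)
  have hx : x ∈ M.closure ∅ := by
    rw [← hindep.closure_inter_closure_eq_closure_empty (Set.toFinite _) (Set.toFinite _)
      hspan hcard]
    exact ⟨AlgebraicIndependent.mem_matroid_closure_iff.mpr h11, hxw⟩
  rw [AlgebraicIndependent.mem_matroid_closure_iff, IntermediateField.isAlgebraic_adjoin_iff,
    Algebra.adjoin_empty] at hx
  exact Subalgebra.isAlgebraic_of_isAlgebraic_bot hx
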